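/- Let τ ∈ ℂ with Im τ > 0 and B ∈ GL_n(ℂ). For all v₁, v₂ ∈ ℂ with v₁ − v₂ ∉ Σ_B and all y₁, y₂ ∈ ℂ with y₂ − y₁ ∉ Λ, the tensor r_B is unitary: r_B(v₂,v₁; y₂,y₁) = −ρ(r_B(v₁,v₂; y₁,y₂)), where ρ : A⊗A → A⊗A is the flip ρ(a⊗b) = b⊗a, A = Mat_{n×n}(ℂ). -/

import Mathlib

open Complex Matrix
open scoped TensorProduct

noncomputable section

/-- π as a complex number. -/
def πc : ℂ := Real.pi

/-- The lattice Λ = ℤ + τℤ ⊂ ℂ. -/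
def latticeL (τ : ℂ) : Set ℂ := {x | ∃ m k : ℤ, x = (m : ℂ) + (k : ℂ) * τ}

/-- Σ_B = {λ − λ' : exp(2πiλ), exp(2πiλ') eigenvalues of B} + Λ. -/
def SigmaSet (n : ℕ) (τ : ℂ) (B : Matrix (Fin n) (Fin n) ℂ) : Set ℂ :=
  {x | ∃ l l' : ℂ, Complex.exp (2 * πc * I * l) ∈ spectrum ℂ B ∧
    Complex.exp (2 * πc * I * l') ∈ spectrum ℂ B ∧
    ∃ w ∈ latticeL τ, x = l - l' + w}

/-- The space of holomorphic matrix-valued functions with Φ(z+1) = Φ(z) and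
Φ(z+τ)·B = c(z)·B·Φ(z). -/
def SolSpace (n : ℕ) (τ : ℂ) (B : Matrix (Fin n) (Fin n) ℂ) (c : ℂ → ℂ) :
    Submodule ℂ (ℂ → Matrix (Fin n) (Fin n) ℂ) where
  carrier := {Φ | (∀ i j, Differentiable ℂ fun z => Φ z i j) ∧
    (∀ z, Φ (z + 1) = Φ z) ∧ (∀ z, Φ (z + τ) * B = c z • (B * Φ z))}
  add_mem' := by
    rintro Φ Ψ ⟨hd, hp, hq⟩ ⟨gd, gp, gq⟩
    refine ⟨fun i j => ?_, fun z => ?_, fun z => ?_⟩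
    · show Differentiable ℂ fun z => Φ z i j + Ψ z i j
      exact (hd i j).add (gd i j)
    · show Φ (z + 1) + Ψ (z + 1) = Φ z + Ψ z
      rw [hp, gp]
    · show (Φ (z + τ) + Ψ (z + τ)) * B = c z • (B * (Φ z + Ψ z))
      rw [add_mul, hq, gq, Matrix.mul_add, smul_add]
  zero_mem' := by
    refine ⟨fun i j => ?_, fun z => rfl, fun z => by simp⟩
    show Differentiable ℂ fun _ => (0 : ℂ)
    exact differentiable_const 0
  smul_mem' := by
    rintro a Φ ⟨hd, hp, hq⟩
    refine ⟨fun i j => ?_, fun z => ?_, fun z => ?_⟩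
    · show Differentiable ℂ fun z => a • Φ z i j
      exact (hd i j).const_smul a
    · show a • Φ (z + 1) = a • Φ z
      rw [hp]
    · show (a • Φ (z + τ)) * B = c z • (B * (a • Φ z))
      rw [Matrix.smul_mul, hq, Matrix.mul_smul, smul_comm]

/-- First Jacobi theta function θ₁(z|τ) = 2q^{1/4} Σ_{m≥0} (−1)^m q^{m(m+1)} sin((2m+1)πz),
with q = exp(πiτ). -/
def theta1 (τ z : ℂ) : ℂ :=
  2 * Complex.exp (πc * I * τ / 4) *
    ∑' m : ℕ, (-1 : ℂ) ^ m * Complex.exp (πc * I * τ * (m * (m + 1))) *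
      Complex.sin ((2 * (m : ℂ) + 1) * πc * z)

/-- Third Jacobi theta function θ₃(z|τ) = Σ_{m∈ℤ} exp(πim²τ + 2πimz). -/
def theta3 (τ z : ℂ) : ℂ :=
  ∑' m : ℤ, Complex.exp (πc * I * (m : ℂ) ^ 2 * τ + 2 * πc * I * (m : ℂ) * z)

/-- The Kronecker function σ(u,x) = θ'(0)θ(u+x)/(θ(u)θ(x)). -/
def kron (τ u x : ℂ) : ℂ :=
  deriv (theta1 τ) 0 * theta1 τ (u + x) / (theta1 τ u * theta1 τ x)

abbrev MatC (n : ℕ) := Matrix (Fin n) (Fin n) ℂ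

/-- The canonical isomorphism Mat ⊗ Mat → End(Mat), X ⊗ Y ↦ (Z ↦ Tr(XZ)·Y). -/
def canM (n : ℕ) : (MatC n ⊗[ℂ] MatC n) →ₗ[ℂ] MatC n →ₗ[ℂ] MatC n :=
  TensorProduct.lift <| LinearMap.mk₂ ℂ
    (fun X Y => ((Matrix.traceLinearMap (Fin n) ℂ ℂ).comp (LinearMap.mulLeft ℂ X)).smulRight Y)
    (fun X X' Y => by ext Z; simp [add_mul, add_smul])
    (fun a X Y => by ext Z; simp [Matrix.smul_mul, smul_smul, mul_assoc])
    (fun X Y Y' => by ext Z; simp [smul_add, mul_add])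
    (fun a X Y => by ext Z; simp [smul_comm, mul_left_comm])

/-- `IsRB n τ B v₁ v₂ y₁ y₂ r` says that the tensor `r` corresponds, under the canonical
map can(X⊗Y)(Z) = Tr(XZ)·Y, to the linear map ev_{y₂} ∘ res_{y₁}⁻¹ on the solution space
Sol_{B, v₁−v₂, y₁}; i.e. r is the tensor r_B(v₁,v₂; y₁,y₂) of the main construction. -/
def IsRB (n : ℕ) (τ : ℂ) (B : Matrix (Fin n) (Fin n) ℂ) (v₁ v₂ y₁ y₂ : ℂ)
    (r : MatC n ⊗[ℂ] MatC n) : Prop :=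
  ∀ Φ ∈ SolSpace n τ B (fun z => -Complex.exp (-(2 * πc * I) * (z + (v₁ - v₂) - y₁ + τ))),
    canM n r (Φ y₁) = (theta3 τ (y₂ - y₁ + (τ + 1) / 2))⁻¹ • Φ y₂

/-- Rotating the index lattice `ℤ × ℤ` by `(m, k) ↦ (m + k, m - k)` identifies it with the two
cosets of `2ℤ × 2ℤ` given by pairs of equal parity. -/
lemma bijective_parity_split : Function.Bijective
    (Sum.elim (fun p : ℤ × ℤ => (p.1 + p.2, p.1 - p.2))
      (fun p : ℤ × ℤ => (p.1 + p.2 + 1, p.1 - p.2))) := by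
  constructor
  · rintro (⟨a, b⟩ | ⟨a, b⟩) (⟨c, d⟩ | ⟨c, d⟩) h <;>
      simp only [Sum.elim_inl, Sum.elim_inr, Prod.mk.injEq, Sum.inl.injEq, Sum.inr.injEq,
        reduceCtorEq] at h ⊢ <;> omega
  · rintro ⟨m, k⟩
    rcases Int.even_or_odd (m + k) with ⟨j, hj⟩ | ⟨j, hj⟩
    · exact ⟨Sum.inl (j, m - j), by simp only [Sum.elim_inl, Prod.mk.injEq]; omega⟩
    · exact ⟨Sum.inr (j, m - j - 1), by simp only [Sum.elim_inr, Prod.mk.injEq]; omega⟩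

/-- The addition formula for `θ(x + y) θ(x - y)` in terms of theta functions of modulus `2τ`. -/
lemma jacobiTheta₂_add_mul_sub {τ : ℂ} (hτ : 0 < τ.im) (x y : ℂ) :
    jacobiTheta₂ (x + y) τ * jacobiTheta₂ (x - y) τ =
      jacobiTheta₂ (2 * x) (2 * τ) * jacobiTheta₂ (2 * y) (2 * τ) +
      (cexp (Real.pi * I * (2 * x + τ / 2)) * jacobiTheta₂ (2 * x + τ) (2 * τ)) *
      (cexp (Real.pi * I * (2 * y + τ / 2)) * jacobiTheta₂ (2 * y + τ) (2 * τ)) := by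
  have h2τ : 0 < (2 * τ).im := by simpa using hτ
  have hs (z : ℂ) {τ : ℂ} (hτ : 0 < τ.im) : Summable fun n : ℤ => ‖jacobiTheta₂_term n z τ‖ :=
    ((summable_jacobiTheta₂_term_iff z τ).2 hτ).norm
  have hmul (z w : ℂ) {τ : ℂ} (hτ : 0 < τ.im) :
      HasSum (fun p : ℤ × ℤ => jacobiTheta₂_term p.1 z τ * jacobiTheta₂_term p.2 w τ)
        (jacobiTheta₂ z τ * jacobiTheta₂ w τ) :=
    HasSum.mul (f := fun n => jacobiTheta₂_term n z τ) (g := fun n => jacobiTheta₂_term n w τ)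
      (hasSum_jacobiTheta₂_term z hτ) (hasSum_jacobiTheta₂_term w hτ)
      (summable_mul_of_summable_norm (f := fun n => jacobiTheta₂_term n z τ)
        (g := fun n => jacobiTheta₂_term n w τ) (hs z hτ) (hs w hτ))
  have h1 := (Equiv.ofBijective _ bijective_parity_split).hasSum_iff.2 (hmul (x + y) (x - y) hτ)
  have heven := hmul (2 * x) (2 * y) h2τ
  have hodd := (hmul (2 * x + τ) (2 * y + τ) h2τ).mul_left
    (cexp (Real.pi * I * (2 * x + τ / 2)) * cexp (Real.pi * I * (2 * y + τ / 2)))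
  rw [mul_mul_mul_comm (cexp _)]
  refine h1.unique (HasSum.sum ?_ ?_)
  on_goal 1 => refine (congrArg (HasSum · _) (funext fun p => ?_)).mpr heven
  on_goal 2 => refine (congrArg (HasSum · _) (funext fun p => ?_)).mpr hodd
  all_goals
    simp only [Function.comp_apply, Equiv.ofBijective_apply, Sum.elim_inl, Sum.elim_inr,
      jacobiTheta₂_term, ← Complex.exp_add]
    congr 1
    push_cast
    ring

lemma exists_jacobiTheta₂_ne_zero {τ : ℂ} (hτ : 0 < τ.im) : ∃ z, jacobiTheta₂ z τ ≠ 0 := by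
  by_contra! h
  have hb (n : ℤ) (x : ℝ) : ‖jacobiTheta₂_term n x τ‖ = ‖jacobiTheta₂_term n 0 τ‖ := by
    simp [norm_jacobiTheta₂_term]
  have key := intervalIntegral.hasSum_intervalIntegral_of_summable_norm (a := 0) (b := 1)
    (f := fun n : ℤ => (⟨fun x : ℝ => jacobiTheta₂_term n x τ, by
      unfold jacobiTheta₂_term; fun_prop⟩ : C(ℝ, ℂ))) (by
      refine ((summable_jacobiTheta₂_term_iff 0 τ).2 hτ).norm.of_nonneg_of_le
        (fun _ => norm_nonneg _) fun n => ?_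
      rw [ContinuousMap.norm_le _ (norm_nonneg _)]
      exact fun x => (hb n x).le)
  have h0 : ∀ x : ℝ, ∑' n : ℤ, jacobiTheta₂_term n x τ = 0 := fun x => h x
  simp only [ContinuousMap.coe_mk, h0, intervalIntegral.integral_zero] at key
  have h1 (n : ℤ) (hn : n ≠ 0) : ∫ x in (0 : ℝ)..1, jacobiTheta₂_term n x τ = 0 := by
    simp only [jacobiTheta₂_term, Complex.exp_add]
    rw [intervalIntegral.integral_mul_const, integral_exp_mul_complex
      (by simp [hn, Real.pi_ne_zero])]
    have : cexp (2 * Real.pi * I * n) = 1 := by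
      rw [mul_comm]; exact Complex.exp_int_mul_two_pi_mul_I n
    simp [this]
  have h2 := key.unique (hasSum_single 0 h1)
  simp [jacobiTheta₂_term] at h2

lemma differentiable_jacobiTheta₂_fst {τ : ℂ} (hτ : 0 < τ.im) :
    Differentiable ℂ (jacobiTheta₂ · τ) :=
  fun z => differentiableAt_jacobiTheta₂_fst z hτ

lemma exists_jacobiTheta₂_mul_ne_zero {τ : ℂ} (hτ : 0 < τ.im) (a b : ℂ) :
    ∃ z, jacobiTheta₂ (z + a) τ * jacobiTheta₂ (z + b) τ ≠ 0 := by
  by_contra! h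
  obtain ⟨w, hw⟩ := exists_jacobiTheta₂_ne_zero hτ
  have hd (c : ℂ) : Differentiable ℂ fun z => jacobiTheta₂ (z + c) τ :=
    (differentiable_jacobiTheta₂_fst hτ).comp (differentiable_id.add_const c)
  have hne : ∀ᶠ z in nhds (w - a), jacobiTheta₂ (z + a) τ ≠ 0 :=
    (hd a).continuous.continuousAt.eventually_ne (by simpa using hw)
  have h0 : (fun z => jacobiTheta₂ (z + b) τ) = fun _ => 0 :=
    AnalyticOnNhd.eq_of_eventuallyEq (z₀ := w - a)
      (fun z _ => (hd b).analyticAt z) (fun z _ => analyticAt_const)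
      (hne.mono fun z hz => (mul_eq_zero.1 (h z)).resolve_left hz)
  exact hw (by simpa using congrFun h0 (w - b))

lemma jacobiTheta₂_half_add_sub {τ : ℂ} (u : ℂ) :
    jacobiTheta₂ ((τ + 1) / 2 - u) τ =
      -cexp (2 * Real.pi * I * u) * jacobiTheta₂ ((τ + 1) / 2 + u) τ := by
  rw [show (τ + 1) / 2 - u = -((τ + 1) / 2 + u) + 1 + τ by ring, jacobiTheta₂_add_left',
    jacobiTheta₂_add_left, jacobiTheta₂_neg_left]
  congr 1
  rw [show -(Real.pi : ℂ) * I * (τ + 2 * (-((τ + 1) / 2 + u) + 1)) =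
    2 * Real.pi * I * u - Real.pi * I by ring, Complex.exp_sub, exp_pi_mul_I]
  ring

lemma jacobiTheta₂_half_eq_zero {τ : ℂ} : jacobiTheta₂ ((τ + 1) / 2) τ = 0 := by
  have h := jacobiTheta₂_half_add_sub (τ := τ) 0
  simp only [sub_zero, mul_zero, Complex.exp_zero, add_zero, neg_mul, one_mul] at h
  exact self_eq_neg.1 h

/-- If `(τ + 1) / 2 + u` is a zero of `θ`, the quotient `θ(s) / θ(s - u)` turns sums into
products. -/
lemma jacobiTheta₂_mul_exchange {τ : ℂ} (hτ : 0 < τ.im) {u : ℂ}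
    (hu : jacobiTheta₂ ((τ + 1) / 2 + u) τ = 0) {s t s' t' : ℂ} (h : s + t = s' + t') :
    jacobiTheta₂ s τ * jacobiTheta₂ t τ * (jacobiTheta₂ (s' - u) τ * jacobiTheta₂ (t' - u) τ) =
    jacobiTheta₂ s' τ * jacobiTheta₂ t' τ * (jacobiTheta₂ (s - u) τ * jacobiTheta₂ (t - u) τ) := by
  set x := (s + t) / 2
  set y := (s - t) / 2
  set y' := (s' - t') / 2
  set y₀ := x - (τ + 1) / 2
  have hu' : jacobiTheta₂ ((τ + 1) / 2 - u) τ = 0 := by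
    rw [jacobiTheta₂_half_add_sub, hu, mul_zero]
  obtain ⟨X, hX⟩ := exists_jacobiTheta₂_mul_ne_zero hτ y₀ (-y₀)
  have e0 : jacobiTheta₂ (x + y₀) τ * jacobiTheta₂ (x - y₀) τ = 0 := by
    rw [show x - y₀ = (τ + 1) / 2 by simp only [y₀]; ring, jacobiTheta₂_half_eq_zero, mul_zero]
  have e1 : jacobiTheta₂ (x - u + y₀) τ * jacobiTheta₂ (x - u - y₀) τ = 0 := by
    rw [show x - u - y₀ = (τ + 1) / 2 - u by simp only [y₀]; ring, hu', mul_zero]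
  rw [show s = x + y by simp only [x, y]; ring, show t = x - y by simp only [x, y]; ring,
    show s' = x + y' by simp only [x, y', h]; ring,
    show t' = x - y' by simp only [x, y', h]; ring,
    show x + y - u = x - u + y by ring, show x - y - u = x - u - y by ring,
    show x + y' - u = x - u + y' by ring, show x - y' - u = x - u - y' by ring]
  rw [← sub_eq_add_neg] at hX
  apply mul_left_cancel₀ hX
  simp only [jacobiTheta₂_add_mul_sub hτ] at e0 e1 ⊢
  set P := fun z => jacobiTheta₂ (2 * z) (2 * τ)
  set E := fun z => cexp (Real.pi * I * (2 * z + τ / 2)) * jacobiTheta₂ (2 * z + τ) (2 * τ)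
  change (P x * P y₀ + E x * E y₀) = 0 at e0
  change (P (x - u) * P y₀ + E (x - u) * E y₀) = 0 at e1
  change (P X * P y₀ + E X * E y₀) * ((P x * P y + E x * E y) *
      (P (x - u) * P y' + E (x - u) * E y')) =
    (P X * P y₀ + E X * E y₀) * ((P x * P y' + E x * E y') * (P (x - u) * P y + E (x - u) * E y))
  linear_combination (P y * E y' - P y' * E y) *
    ((P X * E (x - u) - E X * P (x - u)) * e0 - (P X * E x - E X * P x) * e1)

/-- The zeros of `θ(·, τ)` are exactly the translates of `(τ + 1) / 2` by lattice vectors; this is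
the nontrivial inclusion. -/
theorem exists_of_jacobiTheta₂_half_add_eq_zero {τ : ℂ} (hτ : 0 < τ.im) {u : ℂ}
    (hu : jacobiTheta₂ ((τ + 1) / 2 + u) τ = 0) : ∃ m k : ℤ, u = m + k * τ := by
  set N : ℂ → ℂ := fun z => jacobiTheta₂ z τ with hN
  have hdN : Differentiable ℂ N := differentiable_jacobiTheta₂_fst hτ
  obtain ⟨p, hp⟩ := exists_jacobiTheta₂_mul_ne_zero hτ 0 (-u)
  rw [add_zero, ← sub_eq_add_neg] at hp
  have hp1 : N p ≠ 0 := left_ne_zero_of_mul hp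
  have hp2 : N (p - u) ≠ 0 := right_ne_zero_of_mul hp
  have hD (a z : ℂ) : HasDerivAt (fun y => N (a + y)) (deriv N (a + z)) z :=
    HasDerivAt.comp_const_add a z (hdN _).hasDerivAt
  obtain ⟨c, hc⟩ : ∃ c, ∀ s, deriv N s * N (s - u) - N s * deriv N (s - u) =
      c * (N s * N (s - u)) := by
    refine ⟨(deriv N p * N (p - u) - N p * deriv N (p - u)) / (N p * N (p - u)), fun s => ?_⟩
    have h1 (y : ℂ) : N (s + y) * N p * (N (s - u) * N (p - u + y)) =
        N s * N (p + y) * (N (s - u + y) * N (p - u)) := by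
      have := jacobiTheta₂_mul_exchange hτ hu (show s + y + p = s + (p + y) by ring)
      rw [show p + y - u = p - u + y by ring, show s + y - u = s - u + y by ring] at this
      exact this
    have hl := ((hD s 0).mul_const (N p)).mul ((hD (p - u) 0).const_mul (N (s - u)))
    have hr := ((hD p 0).const_mul (N s)).mul ((hD (s - u) 0).mul_const (N (p - u)))
    have h2 := hl.unique (hr.congr_of_eventuallyEq (Filter.Eventually.of_forall h1))
    simp only [add_zero] at h2
    field_simp
    linear_combination h2
  obtain ⟨K, hK⟩ : ∃ K, ∀ s, N s = K * cexp (c * s) * N (s - u) := by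
    have hcont : Continuous fun z => N (z - u) :=
      hdN.continuous.comp (continuous_id.sub continuous_const)
    obtain ⟨ε, hε, hball⟩ := Metric.eventually_nhds_iff_ball.1
      (hcont.continuousAt.eventually_ne hp2)
    set g : ℂ → ℂ := fun z => N z / N (z - u) * cexp (-(c * z)) with hg
    have hDM (z : ℂ) : HasDerivAt (fun y => N (y - u)) (deriv N (z - u)) z :=
      HasDerivAt.comp_sub_const z u (hdN _).hasDerivAt
    have hgd : ∀ z ∈ Metric.ball p ε, HasDerivAt g 0 z := by
      intro z hz
      have he : HasDerivAt (fun z => cexp (-(c * z))) (cexp (-(c * z)) * (-(c * 1))) z :=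
        (((hasDerivAt_id z).const_mul c).neg).cexp
      have hz0 := hball z hz
      refine (((hdN z).hasDerivAt.fun_div (hDM z) hz0).mul he).congr_deriv ?_
      rw [hc z]
      field_simp
      ring
    have hconst : ∀ z ∈ Metric.ball p ε, g z = g p := fun z hz =>
      (convex_ball p ε).is_const_of_fderivWithin_eq_zero (𝕜 := ℂ)
        (fun w hw => (hgd w hw).differentiableAt.differentiableWithinAt)
        (fun w hw => by
          rw [fderivWithin_of_isOpen Metric.isOpen_ball hw]
          ext
          simpa using (hgd w hw).deriv) hz (Metric.mem_ball_self hε)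
    refine ⟨g p, fun s => congrFun (AnalyticOnNhd.eq_of_eventuallyEq (𝕜 := ℂ) (f := N)
      (g := fun s => g p * cexp (c * s) * N (s - u)) (z₀ := p)
      (fun z _ => hdN.analyticAt z) (fun z _ => ?_) ?_) s⟩
    · refine Differentiable.analyticAt ?_ z
      have : Differentiable ℂ fun s => N (s - u) := fun z => (hDM z).differentiableAt
      fun_prop
    · filter_upwards [Metric.ball_mem_nhds p hε] with z hz
      have hz0 := hball z hz
      rw [← hconst z hz, hg]
      simp only [Complex.exp_neg]
      field_simp
  have hper (z : ℂ) : N (z + 1) = N z := jacobiTheta₂_add_left z τ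
  have hqper (z : ℂ) : N (z + τ) = cexp (-Real.pi * I * (τ + 2 * z)) * N z :=
    jacobiTheta₂_add_left' z τ
  have hKp := hK p
  have hc1 : cexp c = 1 := by
    have h1 := hK (p + 1)
    rw [hper, show p + 1 - u = p - u + 1 by ring, hper, mul_add, mul_one, Complex.exp_add] at h1
    apply mul_left_cancel₀ hp1
    linear_combination -h1 + cexp c * hKp
  have hcτ : cexp (c * τ + 2 * Real.pi * I * u) = 1 := by
    have h1 := hK (p + τ)
    rw [hqper, show p + τ - u = p - u + τ by ring, hqper, mul_add c p τ,
      show -Real.pi * I * (τ + 2 * (p - u)) =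
        -Real.pi * I * (τ + 2 * p) + 2 * Real.pi * I * u by ring] at h1
    rw [Complex.exp_add (_ * _) (2 * Real.pi * I * u), Complex.exp_add (c * p)] at h1
    rw [Complex.exp_add]
    apply mul_left_cancel₀ (mul_ne_zero (Complex.exp_ne_zero (-Real.pi * I * (τ + 2 * p))) hp1)
    linear_combination -h1 + cexp (c * τ) * cexp (2 * Real.pi * I * u) *
      cexp (-Real.pi * I * (τ + 2 * p)) * hKp
  obtain ⟨k, hk⟩ := Complex.exp_eq_one_iff.1 hc1
  obtain ⟨m, hm⟩ := Complex.exp_eq_one_iff.1 hcτ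
  refine ⟨m, -k, mul_left_cancel₀ Complex.two_pi_I_ne_zero ?_⟩
  rw [hk] at hm
  push_cast
  linear_combination hm

section ConjTheta

variable {𝔸 : Type*} [NormedRing 𝔸]

lemma norm_units_pow_le (u : 𝔸ˣ) {ρ : ℝ} (hρ : ‖(u : 𝔸)‖ ≤ Real.exp ρ) (m : ℕ) :
    ‖(↑(u ^ m) : 𝔸)‖ ≤ ‖(1 : 𝔸)‖ * Real.exp (ρ * m) := by
  induction m with
  | zero => simp
  | succ k ih =>
    rw [pow_succ, Units.val_mul, Nat.cast_succ, mul_add, mul_one, Real.exp_add, ← mul_assoc]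
    exact (norm_mul_le _ _).trans (mul_le_mul ih hρ (norm_nonneg _) (by positivity))

lemma exists_norm_units_zpow_le (u : 𝔸ˣ) :
    ∃ ρ : ℝ, ∀ m : ℤ, ‖(↑(u ^ m) : 𝔸)‖ ≤ ‖(1 : 𝔸)‖ * Real.exp (ρ * |(m : ℝ)|) := by
  have hexp (t : ℝ) : t ≤ Real.exp t := by linarith [Real.add_one_le_exp t]
  refine ⟨‖(u : 𝔸)‖ + ‖(↑u⁻¹ : 𝔸)‖, fun m => ?_⟩
  obtain ⟨k, rfl | rfl⟩ := m.eq_nat_or_neg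
  · rw [zpow_natCast, Int.cast_natCast, Nat.abs_cast]
    exact norm_units_pow_le u (le_trans (by simp) (hexp _)) k
  · rw [_root_.zpow_neg, zpow_natCast, ← inv_pow, Int.cast_neg,
      Int.cast_natCast, abs_neg, Nat.abs_cast]
    exact norm_units_pow_le u⁻¹ (le_trans (by simp) (hexp _)) k

variable [NormedAlgebra ℂ 𝔸]

/-- The theta series `∑ₘ exp(2πimz + πim²τ) u⁻ᵐ x uᵐ` in a normed algebra. -/
def conjTheta (τ : ℂ) (u : 𝔸ˣ) (x : 𝔸) (z : ℂ) : 𝔸 :=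
  ∑' m : ℤ, jacobiTheta₂_term m z τ • (↑(u ^ (-m)) * x * ↑(u ^ m) : 𝔸)

lemma conjTheta_add_one (τ : ℂ) (u : 𝔸ˣ) (x : 𝔸) (z : ℂ) :
    conjTheta τ u x (z + 1) = conjTheta τ u x z := by
  refine tsum_congr fun m => ?_
  congr 1
  rw [jacobiTheta₂_term, jacobiTheta₂_term, Complex.exp_eq_exp_iff_exists_int]
  exact ⟨m, by ring⟩

lemma exists_conjTheta_term_bound {τ : ℂ} (hτ : 0 < τ.im) (u : 𝔸ˣ) (x : 𝔸) (S : ℝ) :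
    ∃ b : ℤ → ℝ, Summable b ∧ ∀ m z, |z.im| ≤ S →
      ‖jacobiTheta₂_term m z τ • (↑(u ^ (-m)) * x * ↑(u ^ m) : 𝔸)‖ ≤ b m := by
  obtain ⟨ρ, hρ⟩ := exists_norm_units_zpow_le u
  have hs := (summable_pow_mul_jacobiTheta₂_term_bound (S + ρ / Real.pi) hτ 0).mul_left
    (‖(1 : 𝔸)‖ * ‖x‖ * ‖(1 : 𝔸)‖)
  refine ⟨_, hs, fun m z hz => ?_⟩
  have h1 : ‖(↑(u ^ (-m)) * x * ↑(u ^ m) : 𝔸)‖ ≤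
      ‖(1 : 𝔸)‖ * Real.exp (ρ * |(m : ℝ)|) * ‖x‖ * (‖(1 : 𝔸)‖ * Real.exp (ρ * |(m : ℝ)|)) := by
    have hneg := hρ (-m)
    rw [Int.cast_neg, abs_neg] at hneg
    exact (norm_mul_le _ _).trans (mul_le_mul ((norm_mul_le _ _).trans
      (mul_le_mul_of_nonneg_right hneg (norm_nonneg _))) (hρ m) (norm_nonneg _) (by positivity))
  rw [norm_smul]
  refine (mul_le_mul (norm_jacobiTheta₂_term_le hτ hz le_rfl m) h1 (norm_nonneg _)
    (Real.exp_pos _).le).trans (le_of_eq ?_)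
  have h2 : -Real.pi * (τ.im * (m : ℝ) ^ 2 - 2 * (S + ρ / Real.pi) * |(m : ℝ)|) =
      -Real.pi * (τ.im * (m : ℝ) ^ 2 - 2 * S * |(m : ℝ)|) + ρ * |(m : ℝ)| + ρ * |(m : ℝ)| := by
    field_simp [Real.pi_ne_zero]
    ring
  push_cast
  rw [h2, Real.exp_add, Real.exp_add]
  ring

lemma summable_norm_conjTheta_term {τ : ℂ} (hτ : 0 < τ.im) (u : 𝔸ˣ) (x : 𝔸) (z : ℂ) :
    Summable fun m : ℤ =>
      ‖jacobiTheta₂_term m z τ • (↑(u ^ (-m)) * x * ↑(u ^ m) : 𝔸)‖ := by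
  obtain ⟨b, hb, hle⟩ := exists_conjTheta_term_bound hτ u x |z.im|
  exact hb.of_nonneg_of_le (fun _ => norm_nonneg _) fun m => hle m z le_rfl

variable [CompleteSpace 𝔸]

lemma hasSum_conjTheta {τ : ℂ} (hτ : 0 < τ.im) (u : 𝔸ˣ) (x : 𝔸) (z : ℂ) :
    HasSum (fun m : ℤ => jacobiTheta₂_term m z τ • (↑(u ^ (-m)) * x * ↑(u ^ m) : 𝔸))
      (conjTheta τ u x z) :=
  (summable_norm_conjTheta_term hτ u x z).of_norm.hasSum

lemma differentiable_conjTheta {τ : ℂ} (hτ : 0 < τ.im) (u : 𝔸ˣ) (x : 𝔸) :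
    Differentiable ℂ (conjTheta τ u x) := by
  intro z
  obtain ⟨S, hS⟩ := exists_gt |z.im|
  obtain ⟨b, hb, hle⟩ := exists_conjTheta_term_bound hτ u x S
  have hU : IsOpen {w : ℂ | |w.im| < S} := isOpen_lt (by fun_prop) continuous_const
  refine (differentiableOn_tsum_of_summable_norm hb (fun m => ?_) hU
    fun m w hw => hle m w (le_of_lt hw)).differentiableAt (hU.mem_nhds hS)
  unfold jacobiTheta₂_term
  fun_prop

lemma conjTheta_add_tau {τ : ℂ} (hτ : 0 < τ.im) (u : 𝔸ˣ) (x : 𝔸) (z : ℂ) :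
    conjTheta τ u x (z + τ) =
      cexp (-Real.pi * I * (τ + 2 * z)) • (u * conjTheta τ u x z * ↑u⁻¹) := by
  have h := (((hasSum_conjTheta hτ u x z).mul_left (u : 𝔸)).mul_right (↑u⁻¹ : 𝔸)).const_smul
    (cexp (-Real.pi * I * (τ + 2 * z)))
  refine (hasSum_conjTheta hτ u x (z + τ)).unique ?_
  refine (congrArg (HasSum · _) (funext fun m => ?_)).mp ((Equiv.addRight (1 : ℤ)).hasSum_iff.2 h)
  simp only [Function.comp_apply, Equiv.coe_addRight, mul_smul_comm, smul_mul_assoc, smul_smul]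
  congr 1
  · rw [jacobiTheta₂_term, jacobiTheta₂_term, ← Complex.exp_add]
    congr 1
    push_cast
    ring
  · rw [show -(m + 1) = -1 + -m by ring, _root_.zpow_add u m 1, _root_.zpow_add u (-1)]
    simp [mul_assoc]

lemma isLinearMap_conjTheta {τ : ℂ} (hτ : 0 < τ.im) (u : 𝔸ˣ) (z : ℂ) :
    IsLinearMap ℂ fun x : 𝔸 => conjTheta τ u x z where
  map_add x y := by
    refine (hasSum_conjTheta hτ u (x + y) z).unique ?_
    simpa only [mul_add, add_mul, smul_add] using
      (hasSum_conjTheta hτ u x z).add (hasSum_conjTheta hτ u y z)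
  map_smul a x := by
    refine (hasSum_conjTheta hτ u (a • x) z).unique ?_
    simpa only [mul_smul_comm, smul_mul_assoc, smul_comm _ a] using
      (hasSum_conjTheta hτ u x z).const_smul a

lemma conjTheta_conj {τ : ℂ} (hτ : 0 < τ.im) (u : 𝔸ˣ) (x : 𝔸) (z : ℂ) :
    conjTheta τ u (u * x * ↑u⁻¹) z = u * conjTheta τ u x z * ↑u⁻¹ := by
  refine (hasSum_conjTheta hτ u _ z).unique ?_
  refine (congrArg (HasSum · _) (funext fun m => ?_)).mp
    (((hasSum_conjTheta hτ u x z).mul_left (u : 𝔸)).mul_right (↑u⁻¹ : 𝔸))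
  have h1 : (u : 𝔸) * ↑(u ^ (-m)) = ↑(u ^ (-m)) * u := by
    exact_mod_cast congrArg Units.val ((Commute.refl u).zpow_right (-m)).eq
  have h2 : (↑(u ^ m) : 𝔸) * ↑u⁻¹ = ↑u⁻¹ * ↑(u ^ m) := by
    exact_mod_cast congrArg Units.val ((Commute.refl u).zpow_left m).inv_right.eq
  simp only [mul_smul_comm, smul_mul_assoc]
  congr 1
  calc (u : 𝔸) * (↑(u ^ (-m)) * x * ↑(u ^ m)) * ↑u⁻¹
      = ((u : 𝔸) * ↑(u ^ (-m))) * x * (↑(u ^ m) * ↑u⁻¹) := by simp only [mul_assoc]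
    _ = _ := by rw [h1, h2]; simp only [mul_assoc]

/-- On an eigenvector of conjugation by `u` the series is a shifted scalar theta function. -/
lemma conjTheta_eq_of_conj_eq {τ : ℂ} (hτ : 0 < τ.im) (u : 𝔸ˣ) {x : 𝔸} {l : ℂ}
    (hx : u * x * ↑u⁻¹ = cexp (2 * Real.pi * I * l) • x) (z : ℂ) :
    conjTheta τ u x z = jacobiTheta₂ (z - l) τ • x := by
  have hcomm : (u : 𝔸) * x = cexp (2 * Real.pi * I * l) • (x * u) := by
    rw [← smul_mul_assoc, ← hx, mul_assoc, Units.inv_mul, mul_one]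
  have hinv : (↑u⁻¹ : 𝔸) * x = cexp (-(2 * Real.pi * I * l)) • (x * ↑u⁻¹) := by
    apply u.isUnit.mul_left_cancel
    rw [Units.mul_inv_cancel_left, mul_smul_comm, ← mul_assoc, hcomm, smul_mul_assoc, smul_smul,
      ← Complex.exp_add, neg_add_cancel, Complex.exp_zero, one_smul, mul_assoc, Units.mul_inv,
      mul_one]
  have hpow (m : ℤ) : (↑(u ^ m) : 𝔸) * x = cexp (m * (2 * Real.pi * I * l)) • (x * ↑(u ^ m)) := by
    induction m with
    | zero => simp
    | succ k ih =>
      rw [_root_.zpow_add_one, Units.val_mul, mul_assoc, hcomm, mul_smul_comm, ← mul_assoc, ih,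
        smul_mul_assoc, smul_smul, ← Complex.exp_add, mul_assoc x]
      push_cast
      ring_nf
    | pred k ih =>
      rw [_root_.zpow_sub_one, Units.val_mul, mul_assoc, hinv, mul_smul_comm, ← mul_assoc, ih,
        smul_mul_assoc, smul_smul, ← Complex.exp_add, mul_assoc x]
      push_cast
      ring_nf
  refine (hasSum_conjTheta hτ u x z).unique ?_
  refine (congrArg (HasSum · _) (funext fun m => ?_)).mp
    ((hasSum_jacobiTheta₂_term (z - l) hτ).smul_const x)
  rw [hpow, smul_mul_assoc, smul_smul, mul_assoc x, ← Units.val_mul, ← _root_.zpow_add, neg_add_cancel,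
    zpow_zero, Units.val_one, mul_one, jacobiTheta₂_term, jacobiTheta₂_term, ← Complex.exp_add]
  congr 2
  push_cast
  ring

/-- Under a tracial functional the product of two series is symmetric under negating and
interchanging the arguments. -/
lemma trace_conjTheta_mul_conjTheta {τ : ℂ} (hτ : 0 < τ.im) (u : 𝔸ˣ) (x y : 𝔸)
    (T : 𝔸 →L[ℂ] ℂ) (hT : ∀ a b, T (a * b) = T (b * a)) (p q : ℂ) :
    T (conjTheta τ u x p * conjTheta τ u y q) =
      T (conjTheta τ u x (-q) * conjTheta τ u y (-p)) := by
  have key (p q : ℂ) : HasSum (fun mk : ℤ × ℤ =>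
      jacobiTheta₂_term mk.1 p τ * jacobiTheta₂_term mk.2 q τ *
        T (↑(u ^ (mk.2 - mk.1)) * x * ↑(u ^ (mk.1 - mk.2)) * y))
      (T (conjTheta τ u x p * conjTheta τ u y q)) := by
    have h := HasSum.mul
      (f := fun m : ℤ => jacobiTheta₂_term m p τ • (↑(u ^ (-m)) * x * ↑(u ^ m) : 𝔸))
      (g := fun k : ℤ => jacobiTheta₂_term k q τ • (↑(u ^ (-k)) * y * ↑(u ^ k) : 𝔸))
      (hasSum_conjTheta hτ u x p) (hasSum_conjTheta hτ u y q)
      (summable_mul_of_summable_norm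
        (f := fun m : ℤ => jacobiTheta₂_term m p τ • (↑(u ^ (-m)) * x * ↑(u ^ m) : 𝔸))
        (g := fun k : ℤ => jacobiTheta₂_term k q τ • (↑(u ^ (-k)) * y * ↑(u ^ k) : 𝔸))
        (summable_norm_conjTheta_term hτ u x p)
        (summable_norm_conjTheta_term hτ u y q))
    refine (congrArg (HasSum · _) (funext fun mk => ?_)).mp (h.mapL T)
    obtain ⟨m, k⟩ := mk
    simp only [smul_mul_smul_comm, map_smul, smul_eq_mul]
    congr 1
    rw [sub_eq_add_neg k m, _root_.zpow_add, sub_eq_add_neg m k, _root_.zpow_add, ← mul_assoc, hT]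
    simp only [Units.val_mul, mul_assoc]
  refine (key p q).unique ?_
  have h := ((Equiv.prodComm ℤ ℤ).trans
    ((Equiv.neg ℤ).prodCongr (Equiv.neg ℤ))).hasSum_iff.2 (key (-q) (-p))
  refine (congrArg (HasSum · _) (funext fun mk => ?_)).mp h
  obtain ⟨m, k⟩ := mk
  simp only [Function.comp_apply, Equiv.trans_apply, Equiv.prodComm_apply, Prod.swap_prod_mk,
    Equiv.prodCongr_apply, Prod.map_apply, Equiv.neg_apply, jacobiTheta₂_term, ← Complex.exp_add]
  rw [show -m - -k = k - m by ring, show -k - -m = m - k by ring]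
  congr 2
  push_cast
  ring

end ConjTheta

lemma canM_tmul (n : ℕ) (X Y Z : MatC n) : canM n (X ⊗ₜ Y) Z = (X * Z).trace • Y := rfl

lemma canM_injective (n : ℕ) : Function.Injective (canM n) := by
  let inv : (MatC n →ₗ[ℂ] MatC n) →ₗ[ℂ] (MatC n ⊗[ℂ] MatC n) :=
    ∑ i, ∑ j, (TensorProduct.mk ℂ (MatC n) (MatC n) (Matrix.single j i 1)).comp
      (LinearMap.applyₗ (Matrix.single i j (1 : ℂ)))
  have hinv : inv.comp (canM n) = LinearMap.id := by
    refine TensorProduct.ext' fun X Y => ?_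
    have hX : ∑ i, ∑ j, X j i • Matrix.single j i (1 : ℂ) = X := by
      rw [Finset.sum_comm]
      simpa [Matrix.smul_single] using (Matrix.matrix_eq_sum_single X).symm
    simp only [inv, LinearMap.comp_apply, LinearMap.sum_apply, LinearMap.applyₗ_apply_apply,
      canM_tmul, Matrix.trace_mul_single, TensorProduct.mk_apply, LinearMap.id_apply]
    conv_rhs => rw [← hX]
    simp only [TensorProduct.sum_tmul, TensorProduct.smul_tmul', TensorProduct.tmul_smul]
    simp
  exact Function.LeftInverse.injective fun t => LinearMap.congr_fun hinv t

lemma trace_mul_canM_comm (n : ℕ) (r : MatC n ⊗[ℂ] MatC n) (X Y : MatC n) :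
    (X * canM n (TensorProduct.comm ℂ _ _ r) Y).trace = (canM n r X * Y).trace := by
  induction r with
  | zero => simp
  | tmul a b =>
    simp only [TensorProduct.comm_tmul, canM_tmul, Matrix.mul_smul, Matrix.smul_mul,
      Matrix.trace_smul, smul_eq_mul]
    rw [Matrix.trace_mul_comm X a, mul_comm]
  | add r s hr hs => simp only [map_add, LinearMap.add_apply, mul_add, add_mul, trace_add, hr, hs]

lemma theta3_eq (τ z : ℂ) : theta3 τ z = jacobiTheta₂ z τ := by
  refine tsum_congr fun m => ?_
  rw [jacobiTheta₂_term, πc]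
  ring_nf

/-- If `B` and `μB` are intertwined by a nonzero matrix, then they share an eigenvalue. -/
lemma exists_mem_spectrum_of_mul_eq_smul_mul {n : ℕ} {B X : MatC n} (hX : X ≠ 0) {μ : ℂ}
    (hμ : μ ≠ 0) (h : B * X = μ • (X * B)) :
    ∃ k ∈ spectrum ℂ B, k / μ ∈ spectrum ℂ B := by
  have hn : Nonempty (Fin n) := by
    by_contra hn
    rw [not_nonempty_iff] at hn
    exact hX (Subsingleton.elim _ _)
  have hpoly (p : Polynomial ℂ) :
      Polynomial.aeval B p * X = X * Polynomial.aeval (μ • B) p := by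
    induction p using Polynomial.induction_on' with
    | add p q hp hq => simp only [map_add, add_mul, mul_add, hp, hq]
    | monomial k a =>
      have hs : SemiconjBy X (μ • B) B := by rw [SemiconjBy, Matrix.mul_smul, h]
      simp only [Polynomial.aeval_monomial]
      rw [mul_assoc, ← (hs.pow_right k).eq, ← mul_assoc, ← mul_assoc, Algebra.commutes]
  have h0 : (0 : ℂ) ∈ spectrum ℂ (Polynomial.aeval (μ • B) B.charpoly) := by
    rw [spectrum.zero_mem_iff]
    intro hunit
    have h1 := hpoly B.charpoly
    rw [Matrix.aeval_self_charpoly, zero_mul] at h1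
    exact hX (hunit.mul_left_eq_zero.1 h1.symm)
  rw [spectrum.map_polynomial_aeval_of_degree_pos _ _ (by
    rw [Matrix.charpoly_degree_eq_dim]; exact_mod_cast Fintype.card_pos)] at h0
  obtain ⟨k, hk, hk0⟩ := h0
  refine ⟨k, Matrix.mem_spectrum_iff_isRoot_charpoly.2 hk0, ?_⟩
  have h2 : (Units.mk0 μ hμ) • (k / μ) ∈ spectrum ℂ ((Units.mk0 μ hμ) • B) := by
    change μ * (k / μ) ∈ spectrum ℂ (μ • B)
    rwa [mul_div_cancel₀ _ hμ]
  rwa [spectrum.unit_smul_eq_smul, Set.smul_mem_smul_set_iff] at h2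

section MatrixTheta

attribute [local instance] Matrix.linftyOpNormedRing Matrix.linftyOpNormedAlgebra

/-- Evaluation of the theta series at `v + (τ + 1) / 2` is onto unless `v ∈ Σ_B`. -/
lemma conjTheta_surjective {n : ℕ} {τ : ℂ} (hτ : 0 < τ.im) (U : (MatC n)ˣ) {v : ℂ}
    (hv : v ∉ SigmaSet n τ U) :
    Function.Surjective fun X : MatC n => conjTheta τ U X (v + (τ + 1) / 2) := by
  set L := (isLinearMap_conjTheta hτ U (v + (τ + 1) / 2)).mk' with hL
  change Function.Surjective L
  rw [← LinearMap.injective_iff_surjective, ← LinearMap.ker_eq_bot]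
  by_contra hker
  let A : MatC n →ₗ[ℂ] MatC n :=
    (LinearMap.mulRight ℂ (↑U⁻¹ : MatC n)).comp (LinearMap.mulLeft ℂ (U : MatC n))
  have hA : ∀ X ∈ L.ker, A X ∈ L.ker := by
    intro X hX
    rw [LinearMap.mem_ker] at hX ⊢
    change conjTheta τ U X _ = 0 at hX
    change conjTheta τ U (U * X * ↑U⁻¹) _ = 0
    rw [conjTheta_conj hτ, hX, mul_zero, zero_mul]
  have : Nontrivial L.ker := Submodule.nontrivial_iff_ne_bot.2 hker
  obtain ⟨μ, hμ⟩ := Module.End.exists_eigenvalue (A.restrict hA)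
  obtain ⟨⟨X, hXker⟩, hX⟩ := hμ.exists_hasEigenvector
  have hX0 : X ≠ 0 := fun h => hX.2 (Subtype.ext h)
  have hAX : (U : MatC n) * X * ↑U⁻¹ = μ • X := congrArg Subtype.val hX.apply_eq_smul
  have hUX : (U : MatC n) * X = μ • (X * U) := by
    rw [← Matrix.smul_mul, ← hAX, mul_assoc, Units.inv_mul, mul_one]
  have hμ0 : μ ≠ 0 := by
    rintro rfl
    rw [zero_smul] at hUX
    exact hX0 (U.isUnit.mul_right_eq_zero.1 hUX)
  obtain ⟨l₀, hl₀⟩ : ∃ l₀, cexp l₀ = μ := ⟨Complex.log μ, Complex.exp_log hμ0⟩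
  obtain ⟨l, rfl⟩ : ∃ l, l₀ = 2 * Real.pi * I * l :=
    ⟨l₀ / (2 * Real.pi * I), by rw [mul_div_cancel₀ _ Complex.two_pi_I_ne_zero]⟩
  rw [LinearMap.mem_ker] at hXker
  change conjTheta τ U X _ = 0 at hXker
  rw [conjTheta_eq_of_conj_eq hτ U (hAX.trans (by rw [hl₀])), smul_eq_zero, or_iff_left hX0,
    show v + (τ + 1) / 2 - l = (τ + 1) / 2 + (v - l) by ring] at hXker
  obtain ⟨m, k, hmk⟩ := exists_of_jacobiTheta₂_half_add_eq_zero hτ hXker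
  obtain ⟨c, hc, hcμ⟩ := exists_mem_spectrum_of_mul_eq_smul_mul hX0 hμ0 hUX
  have hc0 : c ≠ 0 := by
    rintro rfl
    exact spectrum.zero_notMem_iff ℂ |>.2 U.isUnit hc
  refine hv ⟨Complex.log c / (2 * Real.pi * I), Complex.log c / (2 * Real.pi * I) - l, ?_, ?_,
    m + k * τ, ⟨m, k, rfl⟩, by linear_combination hmk⟩
  · rwa [πc, mul_div_cancel₀ _ Complex.two_pi_I_ne_zero, Complex.exp_log hc0]
  · rwa [πc, mul_sub, mul_div_cancel₀ _ Complex.two_pi_I_ne_zero, Complex.exp_sub,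
      Complex.exp_log hc0, hl₀]

lemma conjTheta_mem_SolSpace {n : ℕ} {τ : ℂ} (hτ : 0 < τ.im) (U : (MatC n)ˣ) (v y : ℂ)
    (X : MatC n) :
    (fun z => conjTheta τ U X (z + (v - y + (τ + 1) / 2))) ∈
      SolSpace n τ U fun z => -Complex.exp (-(2 * πc * I) * (z + v - y + τ)) := by
  refine ⟨fun i j => ?_, fun z => ?_, fun z => ?_⟩
  · have h : Differentiable ℂ fun z => conjTheta τ U X (z + (v - y + (τ + 1) / 2)) :=
      (differentiable_conjTheta hτ U X).comp (differentiable_id.add_const _)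
    exact (Matrix.entryLinearMap ℂ ℂ i j).toContinuousLinearMap.differentiable.comp h
  · show conjTheta τ U X _ = _
    rw [add_right_comm, conjTheta_add_one]
  · show conjTheta τ U X _ * _ = _ • (_ * conjTheta τ U X _)
    rw [add_right_comm, conjTheta_add_tau hτ, Matrix.smul_mul, mul_assoc (_ * _) _ (U : MatC n),
      Units.inv_mul, mul_one]
    congr 1
    beta_reduce
    rw [πc, show -(Real.pi : ℂ) * I * (τ + 2 * (z + (v - y + (τ + 1) / 2))) =
      -(2 * Real.pi * I) * (z + v - y + τ) - Real.pi * I by ring, Complex.exp_sub, exp_pi_mul_I]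
    ring

/-- The value at `y₂` of the trace of a product of two solutions, for opposite parameters, is
determined by the value at `y₁`. -/
lemma trace_conjTheta_mul_shift {n : ℕ} {τ : ℂ} (hτ : 0 < τ.im) (U : (MatC n)ˣ) (v d : ℂ)
    (X Y : MatC n) :
    (conjTheta τ U X (d + v + (τ + 1) / 2) * conjTheta τ U Y (-v + (τ + 1) / 2)).trace =
      cexp (-(2 * Real.pi * I * d)) *
      (conjTheta τ U X (v + (τ + 1) / 2) * conjTheta τ U Y (-d - v + (τ + 1) / 2)).trace := by
  have hsym : (conjTheta τ U X (v + (τ + 1) / 2) *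
        conjTheta τ U Y (-d - v + (τ + 1) / 2)).trace =
      (conjTheta τ U X (-(-d - v + (τ + 1) / 2)) *
        conjTheta τ U Y (-(v + (τ + 1) / 2))).trace :=
    trace_conjTheta_mul_conjTheta hτ U X Y
      (Matrix.traceLinearMap (Fin n) ℂ ℂ).toContinuousLinearMap
      (fun a b => Matrix.trace_mul_comm a b) (v + (τ + 1) / 2) (-d - v + (τ + 1) / 2)
  rw [hsym, show d + v + (τ + 1) / 2 = -(-d - v + (τ + 1) / 2) + 1 + τ by ring,
    show -v + (τ + 1) / 2 = -(v + (τ + 1) / 2) + 1 + τ by ring, conjTheta_add_tau hτ,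
    conjTheta_add_tau hτ, conjTheta_add_one, conjTheta_add_one, smul_mul_smul_comm,
    Matrix.trace_smul, smul_eq_mul, ← Complex.exp_add]
  congr 1
  · rw [Complex.exp_eq_exp_iff_exists_int]
    exact ⟨-1, by push_cast; ring⟩
  · rw [mul_assoc, mul_assoc, ← mul_assoc (↑U⁻¹ : MatC n), ← mul_assoc (↑U⁻¹ : MatC n),
      Units.inv_mul, one_mul, ← mul_assoc, ← mul_assoc, Matrix.trace_mul_comm, ← mul_assoc,
      ← mul_assoc, Units.inv_mul, one_mul]

end MatrixTheta

/-- Unitarity of r_B: r_B(v₂,v₁; y₂,y₁) = −ρ(r_B(v₁,v₂; y₁,y₂)) where ρ is the flip. -/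
theorem rB_unitary (n : ℕ) (τ : ℂ) (hτ : 0 < τ.im)
    (B : Matrix (Fin n) (Fin n) ℂ) (hB : IsUnit B) (v₁ v₂ y₁ y₂ : ℂ)
    (hv : v₁ - v₂ ∉ SigmaSet n τ B) (hy : y₂ - y₁ ∉ latticeL τ)
    (r r' : MatC n ⊗[ℂ] MatC n)
    (hr : IsRB n τ B v₁ v₂ y₁ y₂ r)
    (hr' : IsRB n τ B v₂ v₁ y₂ y₁ r') :
    r' = - (TensorProduct.comm ℂ (MatC n) (MatC n) r) := by
  obtain ⟨U, rfl⟩ := hB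
  have hv' : v₂ - v₁ ∉ SigmaSet n τ U := by
    rintro ⟨l, l', hl, hl', w, ⟨m, k, hw⟩, h⟩
    exact hv ⟨l', l, hl', hl, -w, ⟨-m, -k, by rw [hw]; push_cast; ring⟩, by linear_combination -h⟩
  apply canM_injective
  ext1 Y
  rw [Matrix.ext_iff_trace_mul_left]
  intro X
  rw [map_neg, LinearMap.neg_apply, mul_neg, Matrix.trace_neg, trace_mul_canM_comm]
  obtain ⟨X, rfl⟩ := conjTheta_surjective hτ U hv X
  obtain ⟨Y, rfl⟩ := conjTheta_surjective hτ U hv' Y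
  have h1 := hr _ (conjTheta_mem_SolSpace hτ U (v₁ - v₂) y₁ X)
  have h2 := hr' _ (conjTheta_mem_SolSpace hτ U (v₂ - v₁) y₂ Y)
  simp only [theta3_eq] at h1 h2
  rw [show y₁ + (v₁ - v₂ - y₁ + (τ + 1) / 2) = v₁ - v₂ + (τ + 1) / 2 by ring,
    show y₂ + (v₁ - v₂ - y₁ + (τ + 1) / 2) = y₂ - y₁ + (v₁ - v₂) + (τ + 1) / 2 by ring,
    show y₂ - y₁ + (τ + 1) / 2 = (τ + 1) / 2 + (y₂ - y₁) by ring] at h1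
  rw [show y₂ + (v₂ - v₁ - y₂ + (τ + 1) / 2) = v₂ - v₁ + (τ + 1) / 2 by ring,
    show y₁ + (v₂ - v₁ - y₂ + (τ + 1) / 2) = -(y₂ - y₁) - (v₁ - v₂) + (τ + 1) / 2 by ring,
    show y₁ - y₂ + (τ + 1) / 2 = (τ + 1) / 2 - (y₂ - y₁) by ring,
    jacobiTheta₂_half_add_sub] at h2
  have h3 := trace_conjTheta_mul_shift hτ U (v₁ - v₂) (y₂ - y₁) X Y
  rw [neg_sub v₁ v₂] at h3
  simp only [h1, h2, Matrix.mul_smul, Matrix.smul_mul, Matrix.trace_smul, smul_eq_mul, h3,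
    Complex.exp_neg, neg_mul, mul_inv, inv_neg]
  ring
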